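/- arXiv:2209.03255 — 2 statements merged into one kernel-verified Lean document; each statement's English description precedes it below -/
import Mathlib

section
/- Let T be a blocktree finset, b ∈ T, and W a finite set of votes. Let H be a finset of validators such that every vote (v, c) ∈ W with v ∈ H has c a descendant of b, every v ∈ H has at least one vote in W, and the cardinality of H is strictly greater than the number of distinct validators not in H that have a vote in W. Then every greedy heaviest chain of (T, W) contains b. -/
/-- `a` is an ancestor of `b` (equivalently, `b` is a descendant of `a`):
`a = parent^[k] b` for some `k ≥ 0`. -/
def Ancestor {B : Type*} (parent : B → B) (a b : B) : Prop :=
  ∃ k : ℕ, a = parent^[k] b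

/-- Blocks `a` and `b` conflict if neither is an ancestor of the other. -/
def Conflicting {B : Type*} (parent : B → B) (a b : B) : Prop :=
  ¬ Ancestor parent a b ∧ ¬ Ancestor parent b a

/-- A finset `T` of blocks is a blocktree finset if it contains the genesis `g`
and is closed under `parent`. -/
def IsBlocktree {B : Type*} (g : B) (parent : B → B) (T : Finset B) : Prop :=
  g ∈ T ∧ ∀ x ∈ T, parent x ∈ T

/-- `c` is a child of `a` in `T`: `c ∈ T`, `c ≠ g`, and `parent c = a`. -/
def IsChild {B : Type*} (g : B) (parent : B → B) (T : Finset B) (a c : B) : Prop :=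
  c ∈ T ∧ c ≠ g ∧ parent c = a

open Classical in
/-- The weight of block `a` w.r.t. the vote set `W`: the number of distinct
validators casting a vote in `W` for a descendant of `a`. -/
noncomputable def wt {B V : Type*} (parent : B → B) (W : Finset (V × B)) (a : B) : ℕ :=
  ((W.filter (fun q => Ancestor parent a q.2)).image Prod.fst).card

/-- `ch 0, ch 1, …, ch k` is a greedy heaviest chain of `(T, W)`:
it starts at the genesis `g`, consists of blocks of `T`, each step goes to a
child of maximal weight, and the endpoint `ch k` has no children in `T`. -/
def IsGreedyChain {B V : Type*} (g : B) (parent : B → B) (T : Finset B)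
    (W : Finset (V × B)) (k : ℕ) (ch : ℕ → B) : Prop :=
  ch 0 = g ∧ (∀ i ≤ k, ch i ∈ T) ∧
  (∀ i < k, IsChild g parent T (ch i) (ch (i + 1)) ∧
      ∀ c', IsChild g parent T (ch i) c' → wt parent W c' ≤ wt parent W (ch (i + 1))) ∧
  ∀ c', ¬ IsChild g parent T (ch k) c'

/-- Being an ancestor is transitive. -/
theorem Ancestor.trans {B : Type*} {parent : B → B} {a b c : B}
    (hab : Ancestor parent a b) (hbc : Ancestor parent b c) : Ancestor parent a c := by
  obtain ⟨m, rfl⟩ := hab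
  obtain ⟨n, rfl⟩ := hbc
  exact ⟨m + n, (Function.iterate_add_apply parent m n c).symm⟩

/-- A periodic block is the genesis block. -/
theorem eq_genesis_of_iterate_eq_self {B : Type*} {g : B} {parent : B → B}
    (hpg : parent g = g) {x : B} (hx : Ancestor parent g x) {d : ℕ} (hd : 0 < d)
    (h : parent^[d] x = x) : x = g := by
  obtain ⟨j, hj⟩ := hx
  have hper : parent^[d * j] x = x := by
    rw [Function.iterate_mul]
    exact Function.iterate_fixed h j
  have hle : j ≤ d * j := Nat.le_mul_of_pos_left j hd
  rw [← Nat.sub_add_cancel hle, Function.iterate_add_apply, ← hj,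
    Function.iterate_fixed hpg] at hper
  exact hper.symm

/-- Two non-genesis blocks with the same parent and a common descendant are equal. -/
theorem eq_of_parent_eq_of_common_descendant {B : Type*} {g : B} {parent : B → B}
    (hpg : parent g = g) (hanc : ∀ x, Ancestor parent g x) {c c' x : B}
    (hc : c ≠ g) (hc' : c' ≠ g) (hp : parent c = parent c')
    (hx : Ancestor parent c x) (hx' : Ancestor parent c' x) : c = c' := by
  obtain ⟨m, hm⟩ := hx
  obtain ⟨n, hn⟩ := hx'
  have key : ∀ {y z : B} {m n : ℕ}, z ≠ g → parent y = parent z →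
      y = parent^[m] x → z = parent^[n] x → ¬ m < n := by
    intro y z m n hz hyz hy hz' hlt
    obtain ⟨d, rfl⟩ := Nat.exists_eq_add_of_lt hlt
    refine hz (eq_genesis_of_iterate_eq_self hpg (hanc z) (Nat.succ_pos d) ?_)
    rw [Function.iterate_succ_apply, ← hyz, ← Function.iterate_succ_apply, hy,
      ← Function.iterate_add_apply, hz', Nat.succ_eq_add_one,
      show d + 1 + m = m + d + 1 by omega]
  have h₁ := key hc' hp hm hn
  have h₂ := key hc hp.symm hn hm
  obtain rfl : m = n := by omega
  exact hm.trans hn.symm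

/-- A blocktree is closed under ancestors. -/
theorem IsBlocktree.mem_of_ancestor {B : Type*} {g : B} {parent : B → B} {T : Finset B}
    (hT : IsBlocktree g parent T) {a b : B} (hab : Ancestor parent a b) (hb : b ∈ T) :
    a ∈ T := by
  obtain ⟨m, rfl⟩ := hab
  induction m with
  | zero => exact hb
  | succ m ih =>
    rw [Function.iterate_succ_apply']
    exact hT.2 _ ih

/-- A proper ancestor of a block `b` of a blocktree has a child that is an ancestor of `b`. -/
theorem exists_isChild_ancestor {B : Type*} {g : B} {parent : B → B} {T : Finset B}
    (hpg : parent g = g) (hT : IsBlocktree g parent T) {a b : B} (hb : b ∈ T)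
    (hab : Ancestor parent a b) (hne : a ≠ b) :
    ∃ c, IsChild g parent T a c ∧ Ancestor parent c b := by
  obtain ⟨m, hm⟩ := hab
  induction m with
  | zero => exact absurd hm hne
  | succ m ih =>
    rw [Function.iterate_succ_apply'] at hm
    by_cases hg : parent^[m] b = g
    · exact ih (by rw [hm, hg, hpg])
    · exact ⟨_, ⟨hT.mem_of_ancestor ⟨m, rfl⟩ hb, hg, hm.symm⟩, m, rfl⟩

/-- An ancestor of `b` has weight at least the number of validators voting below `b`. -/
theorem card_le_wt {B V : Type*} {parent : B → B} {W : Finset (V × B)} {H : Finset V} {b c : B}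
    (hHvotes : ∀ v c, (v, c) ∈ W → v ∈ H → Ancestor parent b c)
    (hHnonempty : ∀ v ∈ H, ∃ c, (v, c) ∈ W) (hcb : Ancestor parent c b) :
    H.card ≤ wt parent W c := by
  classical
  refine Finset.card_le_card fun v hv => ?_
  obtain ⟨x, hx⟩ := hHnonempty v hv
  exact Finset.mem_image.2
    ⟨(v, x), Finset.mem_filter.2 ⟨hx, hcb.trans (hHvotes v x hx hv)⟩, rfl⟩

/-- If no validator of `H` votes below `c`, then only validators outside `H` contribute to the
weight of `c`. -/
theorem wt_le_card_of_not_ancestor {B V : Type*} [DecidableEq V] {parent : B → B}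
    {W : Finset (V × B)} {H : Finset V} {c : B}
    (h : ∀ v x, (v, x) ∈ W → v ∈ H → ¬ Ancestor parent c x) :
    wt parent W c ≤ ((W.filter (fun q => q.1 ∉ H)).image Prod.fst).card := by
  refine Finset.card_le_card fun v hv => ?_
  simp only [Finset.mem_image, Finset.mem_filter] at hv ⊢
  obtain ⟨⟨w, x⟩, ⟨hW, hx⟩, rfl⟩ := hv
  exact ⟨(w, x), ⟨hW, fun hw => h w x hW hw hx⟩, rfl⟩

/-- If all votes in `W` by validators of `H` are for descendants
of `b ∈ T`, every validator in `H` has a vote in `W`, and `H` is strictly larger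
than the set of validators outside `H` with a vote in `W`, then every greedy
heaviest chain of `(T, W)` contains `b`. -/
theorem greedy_chain_contains_of_honest_majority
    {B V : Type*} [DecidableEq B] [DecidableEq V]
    (g : B) (parent : B → B) (hpg : parent g = g) (hanc : ∀ x, Ancestor parent g x)
    (T : Finset B) (hT : IsBlocktree g parent T)
    (b : B) (hb : b ∈ T) (W : Finset (V × B)) (H : Finset V)
    (hHvotes : ∀ v c, (v, c) ∈ W → v ∈ H → Ancestor parent b c)
    (hHnonempty : ∀ v ∈ H, ∃ c, (v, c) ∈ W)
    (hmaj : ((W.filter (fun q => q.1 ∉ H)).image Prod.fst).card < H.card)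
    (k : ℕ) (ch : ℕ → B) (hch : IsGreedyChain g parent T W k ch) :
    ∃ i ≤ k, ch i = b := by
  obtain ⟨h0, -, hstep, hend⟩ := hch
  by_contra! hne
  have hall : ∀ i ≤ k, Ancestor parent (ch i) b := by
    intro i
    induction i with
    | zero => exact fun _ => h0 ▸ hanc b
    | succ i ih =>
      intro hi
      obtain ⟨c, hc, hcb⟩ :=
        exists_isChild_ancestor hpg hT hb (ih (by omega)) (hne i (by omega))
      obtain ⟨hchild, hmax⟩ := hstep i hi
      by_contra hnot
      have hle := wt_le_card_of_not_ancestor (parent := parent) (W := W) (H := H)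
        (c := ch (i + 1)) fun v x hW hv hx => hnot <| by
          rwa [← eq_of_parent_eq_of_common_descendant hpg hanc hc.2.1 hchild.2.1
            (hc.2.2.trans hchild.2.2.symm) (hcb.trans (hHvotes v x hW hv)) hx]
      have hge := card_le_wt hHvotes hHnonempty hcb
      have := hmax c hc
      omega
  obtain ⟨c, hc, -⟩ := exists_isChild_ancestor hpg hT hb (hall k le_rfl) (hne k le_rfl)
  exact hend c hc
end

section
/- (Fast-confirmation counting with equivocation discounting.) Let ε > 0 and M > 0 be real numbers, E a finset of validators with |E| ≤ (1+ε)·M, and W a finite set of votes all of whose validators lie in E. Let b be a block such that the number of distinct validators v with (v, b) ∈ W is at least (3/4+ε)·M, and suppose the number of equivocators in W is strictly less than (1/2)·M. Then the number of distinct validators v that are not equivocators in W and satisfy (v, b) ∈ W is strictly greater than (1/4+ε)·M; for every block c conflicting with b, the discounted weight wt*(W, c) is at most (1/4)·M; and for every blocktree finset T with b ∈ T, every discounted greedy heaviest chain of (T, W) contains b. -/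
open Classical in
/-- The equivocators in a vote set `W`: validators with votes in `W` for two
different blocks. -/
noncomputable def Equivocators {B V : Type*} (W : Finset (V × B)) : Finset V :=
  (W.image Prod.fst).filter (fun v => ∃ c c', (v, c) ∈ W ∧ (v, c') ∈ W ∧ c ≠ c')

open Classical in
/-- The discounted weight of block `a` w.r.t. the vote set `W`: the number of
distinct non-equivocating validators casting a vote in `W` for a descendant
of `a`. -/
noncomputable def wtD {B V : Type*} (parent : B → B) (W : Finset (V × B)) (a : B) : ℕ :=
  ((W.filter (fun q => q.1 ∉ Equivocators W ∧ Ancestor parent a q.2)).image Prod.fst).card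

/-- Discounted greedy heaviest chain of `(T, W)`: as `IsGreedyChain` but using
the discounted weight `wtD`. -/
def IsGreedyChainD {B V : Type*} (g : B) (parent : B → B) (T : Finset B)
    (W : Finset (V × B)) (k : ℕ) (ch : ℕ → B) : Prop :=
  ch 0 = g ∧ (∀ i ≤ k, ch i ∈ T) ∧
  (∀ i < k, IsChild g parent T (ch i) (ch (i + 1)) ∧
      ∀ c', IsChild g parent T (ch i) c' → wtD parent W c' ≤ wtD parent W (ch (i + 1))) ∧
  ∀ c', ¬ IsChild g parent T (ch k) c'

theorem IsBlocktree.iterate_mem {B : Type*} {g : B} {parent : B → B} {T : Finset B}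
    (hT : IsBlocktree g parent T) {b : B} (hb : b ∈ T) (n : ℕ) : parent^[n] b ∈ T := by
  induction n with
  | zero => exact hb
  | succ m ih =>
    rw [Function.iterate_succ_apply']
    exact hT.2 _ ih

/-- A proper ancestor of a block `b` of a blocktree has a child on the path to `b`. -/
theorem IsBlocktree.exists_isChild {B : Type*} {g : B} {parent : B → B} {T : Finset B}
    (hT : IsBlocktree g parent T) (hpg : parent g = g) {a b : B} (hb : b ∈ T)
    (hab : Ancestor parent a b) (hne : a ≠ b) :
    ∃ c, IsChild g parent T a c ∧ Ancestor parent c b := by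
  obtain ⟨n, hn⟩ := hab
  induction n with
  | zero => exact absurd hn hne
  | succ m ih =>
    rw [Function.iterate_succ_apply'] at hn
    by_cases hg : parent^[m] b = g
    · exact ih (by rw [hn, hg, hpg])
    · exact ⟨_, ⟨hT.iterate_mem hb m, hg, hn.symm⟩, m, rfl⟩

theorem eq_of_notMem_equivocators {B V : Type*} {W : Finset (V × B)} {v : V} {c d : B}
    (hv : v ∉ Equivocators W) (hc : (v, c) ∈ W) (hd : (v, d) ∈ W) : c = d := by
  classical
  by_contra hne
  exact hv (Finset.mem_filter.2
    ⟨Finset.mem_image_of_mem Prod.fst hc, c, d, hc, hd, hne⟩)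

theorem card_voters_le_add_card_equivocators {B V : Type*} [DecidableEq B] [DecidableEq V]
    (W : Finset (V × B)) (b : B)
    [DecidablePred fun q : V × B => q.2 = b ∧ q.1 ∉ Equivocators W] :
    ((W.filter (fun q => q.2 = b)).image Prod.fst).card ≤
      ((W.filter (fun q => q.2 = b ∧ q.1 ∉ Equivocators W)).image Prod.fst).card +
        (Equivocators W).card := by
  refine (Finset.card_le_card fun v hv => ?_).trans (Finset.card_union_le _ _)
  simp only [Finset.mem_union, Finset.mem_image, Finset.mem_filter] at hv ⊢
  obtain ⟨q, ⟨hq, hqb⟩, rfl⟩ := hv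
  by_cases he : q.1 ∈ Equivocators W
  · exact Or.inr he
  · exact Or.inl ⟨q, ⟨hq, hqb, he⟩, rfl⟩

theorem card_honest_voters_le_wtD {B V : Type*} [DecidableEq V] (parent : B → B)
    (W : Finset (V × B)) {a b : B} (hab : Ancestor parent a b)
    [DecidablePred fun q : V × B => q.2 = b ∧ q.1 ∉ Equivocators W] :
    ((W.filter (fun q => q.2 = b ∧ q.1 ∉ Equivocators W)).image Prod.fst).card ≤
      wtD parent W a := by
  classical
  unfold wtD
  refine Finset.card_le_card fun v hv => ?_
  simp only [Finset.mem_image, Finset.mem_filter] at hv ⊢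
  obtain ⟨q, ⟨hq, hqb, he⟩, rfl⟩ := hv
  exact ⟨q, ⟨hq, he, hqb.symm ▸ hab⟩, rfl⟩

/-- Voters for `b` do not contribute to the discounted weight of a block that is not an
ancestor of `b`. -/
theorem wtD_add_card_voters_le {B V : Type*} [DecidableEq B] [DecidableEq V] (parent : B → B)
    {E : Finset V} {W : Finset (V × B)} (hWE : ∀ q ∈ W, q.1 ∈ E) {b c : B}
    (hc : ¬ Ancestor parent c b) :
    wtD parent W c + ((W.filter (fun q => q.2 = b)).image Prod.fst).card ≤ E.card := by
  classical
  have hdisj : Disjoint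
      ((W.filter (fun q => q.1 ∉ Equivocators W ∧ Ancestor parent c q.2)).image Prod.fst)
      ((W.filter (fun q => q.2 = b)).image Prod.fst) := by
    refine Finset.disjoint_left.2 fun v hv hv' => ?_
    simp only [Finset.mem_image, Finset.mem_filter] at hv hv'
    obtain ⟨⟨v, d⟩, ⟨hd, he, hcd⟩, rfl⟩ := hv
    obtain ⟨⟨w, d'⟩, ⟨hd', rfl⟩, rfl⟩ := hv'
    exact hc (eq_of_notMem_equivocators he hd hd' ▸ hcd)
  have hsub := Finset.card_le_card (Finset.union_subset
    (Finset.image_subset_iff.2 fun q hq => hWE q (Finset.mem_of_mem_filter q hq))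
    (Finset.image_subset_iff.2 fun q hq => hWE q (Finset.mem_of_mem_filter q hq)) :
    ((W.filter (fun q => q.1 ∉ Equivocators W ∧ Ancestor parent c q.2)).image Prod.fst) ∪
      ((W.filter (fun q => q.2 = b)).image Prod.fst) ⊆ E)
  rw [Finset.card_union_of_disjoint hdisj] at hsub
  unfold wtD
  convert hsub

/-- If every ancestor of `b` has larger discounted weight than every block that is not an
ancestor of `b`, then discounted greedy heaviest chains contain `b`. -/
theorem IsGreedyChainD.exists_eq {B V : Type*} {g : B} {parent : B → B} (hpg : parent g = g)
    {T : Finset B} (hT : IsBlocktree g parent T) {W : Finset (V × B)} {k : ℕ} {ch : ℕ → B}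
    (hch : IsGreedyChainD g parent T W k ch) {b : B} (hb : b ∈ T) (hgb : Ancestor parent g b)
    (hlt : ∀ a c, Ancestor parent a b → ¬ Ancestor parent c b →
      wtD parent W c < wtD parent W a) :
    ∃ i ≤ k, ch i = b := by
  obtain ⟨h0, -, hstep, hend⟩ := hch
  by_contra! hne
  have key : ∀ i ≤ k, Ancestor parent (ch i) b := by
    intro i
    induction i with
    | zero => exact fun _ => h0 ▸ hgb
    | succ i ih =>
      intro hi
      obtain ⟨c, hc, hcb⟩ :=
        hT.exists_isChild hpg hb (ih (by omega)) (hne i (by omega))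
      by_contra hnot
      exact absurd ((hstep i hi).2 c hc) (hlt c _ hcb hnot).not_ge
  obtain ⟨c, hc, -⟩ := hT.exists_isChild hpg hb (key k le_rfl) (hne k le_rfl)
  exact hend c hc

/-- **Fast-confirmation counting with equivocation discounting.**
Under the hypotheses of Statement 5, more than `(1/4+ε)M` distinct
non-equivocating validators vote for `b` in `W`, every block conflicting with
`b` has discounted weight at most `(1/4)M`, and every discounted greedy
heaviest chain of `(T, W)` for any blocktree finset `T` containing `b`
contains `b`. -/
theorem fast_confirmation_discounted
    {B V : Type*} [DecidableEq B] [DecidableEq V]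
    (g : B) (parent : B → B) (hpg : parent g = g) (hanc : ∀ x, Ancestor parent g x)
    (ε M : ℝ) (hε : 0 < ε) (hM : 0 < M)
    (E : Finset V) (hE : (E.card : ℝ) ≤ (1 + ε) * M)
    (W : Finset (V × B)) (hWE : ∀ q ∈ W, q.1 ∈ E)
    (b : B)
    (hvotes : (3 / 4 + ε) * M ≤ (((W.filter (fun q => q.2 = b)).image Prod.fst).card : ℝ))
    (hequiv : ((Equivocators W).card : ℝ) < (1 / 2) * M) :
    (1 / 4 + ε) * M <
        (((W.filter (fun q => q.2 = b ∧ q.1 ∉ Equivocators W)).image Prod.fst).card : ℝ) ∧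
    (∀ c, Conflicting parent b c → (wtD parent W c : ℝ) ≤ (1 / 4) * M) ∧
      ∀ T : Finset B, IsBlocktree g parent T → b ∈ T →
        ∀ k ch, IsGreedyChainD g parent T W k ch → ∃ i ≤ k, ch i = b := by
  have hhonest : (1 / 4 + ε) * M <
      (((W.filter (fun q => q.2 = b ∧ q.1 ∉ Equivocators W)).image Prod.fst).card : ℝ) := by
    have h : (((W.filter (fun q => q.2 = b)).image Prod.fst).card : ℝ) ≤
        ((W.filter (fun q => q.2 = b ∧ q.1 ∉ Equivocators W)).image Prod.fst).card +
          (Equivocators W).card := by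
      exact_mod_cast card_voters_le_add_card_equivocators W b
    linarith
  have hlight : ∀ c, ¬ Ancestor parent c b → (wtD parent W c : ℝ) ≤ (1 / 4) * M := by
    intro c hc
    have h : (wtD parent W c : ℝ) + ((W.filter (fun q => q.2 = b)).image Prod.fst).card ≤
        E.card := by
      exact_mod_cast wtD_add_card_voters_le parent hWE hc
    linarith
  refine ⟨hhonest, fun c hc => hlight c hc.2, fun T hT hb k ch hch =>
    hch.exists_eq hpg hT hb (hanc b) fun a c ha hc => ?_⟩
  have h : (((W.filter (fun q => q.2 = b ∧ q.1 ∉ Equivocators W)).image Prod.fst).card : ℝ) ≤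
      wtD parent W a := by
    exact_mod_cast card_honest_voters_le_wtD parent W ha
  have hεM : 0 < ε * M := mul_pos hε hM
  have hcM := hlight c hc
  exact_mod_cast (by linarith : (wtD parent W c : ℝ) < wtD parent W a)
end
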